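/- Let a and b be positive integers with b² < 4a and 3a < b² + 2b + 4. Suppose that either a and b are both odd, or a ≡ 2 (mod 4) and b is even. Then there exist nonnegative integers s, t, u, v such that a = s² + t² + u² + v² and b = s + t + u + v. -/

import Mathlib

/-- Nearest-multiple reduction. -/
lemma exists_shift (a t : ℤ) (ha : 0 < a) : ∃ k : ℤ, 2 * (t + k * a) ≤ a ∧ -a ≤ 2 * (t + k * a) := by
  refine ⟨-((2 * t + a) / (2 * a)), ?_, ?_⟩
  · have h := Int.emod_add_mul_ediv (2 * t + a) (2 * a)
    have h2 := Int.emod_lt_of_pos (2 * t + a) (show 0 < 2 * a by omega)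
    linarith
  · have h := Int.emod_add_mul_ediv (2 * t + a) (2 * a)
    have h2 := Int.emod_nonneg (2 * t + a) (show 2 * a ≠ 0 by omega)
    linarith

/-- Reduction of positive definite binary forms. -/
lemma binary_reduce (m : ℕ) : ∀ P Q R D : ℤ, P.toNat ≤ m → 0 < P → P * R - Q ^ 2 = D → 0 < D →
    ∃ α β γ δ : ℤ, α * δ - β * γ = 1 ∧
      0 < P * α ^ 2 + 2 * Q * α * γ + R * γ ^ 2 ∧
      3 * (P * α ^ 2 + 2 * Q * α * γ + R * γ ^ 2) ^ 2 ≤ 4 * D := by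
  induction m with
  | zero => intro P Q R D h hP; omega
  | succ m ih =>
    intro P Q R D h hP hD hD0
    obtain ⟨k, hk1, hk2⟩ := exists_shift P Q hP
    set Q' := Q + k * P with hQ'
    set R' := R + 2 * k * Q + k ^ 2 * P with hR'
    have hD' : P * R' - Q' ^ 2 = D := by rw [← hD, hQ', hR']; ring
    have hsq : 4 * Q' ^ 2 ≤ P ^ 2 := by nlinarith
    by_cases hlt : R' < P
    · have hR0 : 0 < R' := by
        by_contra hcon
        nlinarith [sq_nonneg Q']
      obtain ⟨α, β, γ, δ, hdet, hpos, hle⟩ := ih R' (-Q') P D (by omega) hR0 (by rw [← hD']; ring) hD0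
      have e : P * (k * α - γ) ^ 2 + 2 * Q * (k * α - γ) * α + R * α ^ 2
          = R' * α ^ 2 + 2 * (-Q') * α * γ + P * γ ^ 2 := by rw [hQ', hR']; ring
      refine ⟨k * α - γ, k * β - δ, α, β, by rw [← hdet]; ring, ?_, ?_⟩
      · rw [e]; exact hpos
      · rw [e]; exact hle
    · refine ⟨1, 0, 0, 1, by ring, by simpa using hP, ?_⟩
      have : P * P ≤ P * R' := by nlinarith
      nlinarith

lemma binary_two_squares (P Q R : ℤ) (hP : 0 < P) (hD : P * R - Q ^ 2 = 1) (y z : ℤ) :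
    ∃ u v : ℤ, P * y ^ 2 + 2 * Q * y * z + R * z ^ 2 = u ^ 2 + v ^ 2 := by
  obtain ⟨α, β, γ, δ, hdet, hpos, hle⟩ := binary_reduce P.toNat P Q R 1 le_rfl hP hD one_pos
  have h1 : P * α ^ 2 + 2 * Q * α * γ + R * γ ^ 2 = 1 := by nlinarith
  set Q' := P * α * β + Q * (α * δ + β * γ) + R * γ * δ with hQ'
  set R' := P * β ^ 2 + 2 * Q * β * δ + R * δ ^ 2 with hR'
  have hR1 : R' = Q' ^ 2 + 1 := by
    have : (P * α ^ 2 + 2 * Q * α * γ + R * γ ^ 2) * R' - Q' ^ 2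
        = (P * R - Q ^ 2) * (α * δ - β * γ) ^ 2 := by rw [hQ', hR']; ring
    rw [h1, hD, hdet] at this
    linarith
  -- inverse substitution
  set Y := δ * y - β * z with hY
  set Z := -γ * y + α * z with hZ
  have hy : y = α * Y + β * Z := by
    rw [hY, hZ]; linear_combination (-y) * hdet
  have hz : z = γ * Y + δ * Z := by
    rw [hY, hZ]; linear_combination (-z) * hdet
  refine ⟨Y + Q' * Z, Z, ?_⟩
  have : P * y ^ 2 + 2 * Q * y * z + R * z ^ 2
      = (P * α ^ 2 + 2 * Q * α * γ + R * γ ^ 2) * Y ^ 2 + 2 * Q' * Y * Z + R' * Z ^ 2 := by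
    rw [hQ', hR']
    clear_value Y Z
    rw [hy, hz]; ring
  rw [this, h1, hR1]; ring

lemma ternary_step (a b t P : ℤ) (ha : 2 ≤ a) (hP : a * b - t ^ 2 = P) (hpos : 0 < P)
    (hle : 3 * P ^ 2 ≤ 4 * a) (h1 : 2 * t ≤ a) (h2 : -a ≤ 2 * t) : 0 < b ∧ b < a := by
  have hsq : 4 * t ^ 2 ≤ a ^ 2 := by nlinarith
  constructor
  · by_contra hcon
    nlinarith [sq_nonneg t]
  · by_contra hcon
    push Not at hcon
    have h1 : a * a ≤ a * b := by nlinarith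
    have h2 : 3 * a ^ 2 ≤ 4 * P := by nlinarith
    have h4 : 3 * a ^ 2 * (3 * a ^ 2) ≤ 4 * P * (4 * P) := by
      apply mul_le_mul h2 h2 (by positivity) (by positivity)
    have h5 : 27 * a ^ 4 ≤ 64 * a := by nlinarith
    have h6 : 8 * a ≤ a ^ 4 := by
      have : 8 ≤ a ^ 3 := by
        calc (8:ℤ) = 2 ^ 3 := by norm_num
          _ ≤ a ^ 3 := by gcongr
      nlinarith
    linarith

/-- Positive definite integral ternary forms of determinant one represent only sums of
three squares. -/
lemma ternary_three_squares (m : ℕ) : ∀ a b c r s t : ℤ, a.toNat ≤ m → 0 < a → 0 < a * b - t ^ 2 →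
    a * b * c + 2 * r * s * t - a * r ^ 2 - b * s ^ 2 - c * t ^ 2 = 1 →
    ∀ x y z : ℤ, ∃ u v w : ℤ,
      a * x ^ 2 + b * y ^ 2 + c * z ^ 2 + 2 * r * y * z + 2 * s * x * z + 2 * t * x * y
        = u ^ 2 + v ^ 2 + w ^ 2 := by
  induction m with
  | zero => intro a b c r s t h ha; omega
  | succ m ih =>
    intro a b c r s t h ha hP hdet x y z
    by_cases ha1 : a = 1
    · subst ha1
      obtain ⟨u, v, huv⟩ := binary_two_squares (1 * b - t ^ 2) (r - t * s) (c - s ^ 2) hP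
        (by linear_combination hdet) y z
      exact ⟨x + t * y + s * z, u, v, by rw [add_assoc ((x + t * y + s * z) ^ 2), ← huv]; ring⟩
    · obtain ⟨α, β, γ, δ, hd1, hpos, hle⟩ := binary_reduce _ (a * b - t ^ 2) (a * r - t * s)
        (a * c - s ^ 2) a le_rfl hP (by linear_combination a * hdet) ha
      obtain ⟨k, hk1, hk2⟩ := exists_shift a (t * α + s * γ) ha
      set t1 := t * α + s * γ with ht1
      set s1 := t * β + s * δ with hs1
      set b1 := b * α ^ 2 + 2 * r * α * γ + c * γ ^ 2 with hb1
      set c1 := b * β ^ 2 + 2 * r * β * δ + c * δ ^ 2 with hc1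
      set r1 := b * α * β + r * (α * δ + β * γ) + c * γ * δ with hr1
      set t2 := t1 + k * a with ht2
      set b2 := b1 + 2 * k * t1 + k ^ 2 * a with hb2
      set r2 := r1 + k * s1 with hr2
      set P' := (a * b - t ^ 2) * α ^ 2 + 2 * (a * r - t * s) * α * γ + (a * c - s ^ 2) * γ ^ 2 with hP'
      have hPe : a * b2 - t2 ^ 2 = P' := by
        rw [hb2, ht2, hP', hb1, ht1]; ring
      obtain ⟨hb0, hlt⟩ := ternary_step a b2 t2 P' (by omega) hPe hpos hle hk1 hk2
      have hdet2 : b2 * a * c1 + 2 * s1 * r2 * t2 - b2 * s1 ^ 2 - a * r2 ^ 2 - c1 * t2 ^ 2 = 1 := by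
        have : b2 * a * c1 + 2 * s1 * r2 * t2 - b2 * s1 ^ 2 - a * r2 ^ 2 - c1 * t2 ^ 2
          = (a * b * c + 2 * r * s * t - a * r ^ 2 - b * s ^ 2 - c * t ^ 2)
            * (α * δ - β * γ) ^ 2 := by
          rw [hb2, hr2, ht2, hb1, hc1, hr1, hs1, ht1]; ring
        rw [this, hdet, hd1]; norm_num
      -- inverse substitution
      set Y := δ * y - β * z with hY
      set Z := -γ * y + α * z with hZ
      have hy : y = α * Y + β * Z := by
        rw [hY, hZ]; linear_combination (-y) * hd1
      have hz : z = γ * Y + δ * Z := by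
        rw [hY, hZ]; linear_combination (-z) * hd1
      obtain ⟨u, v, w, huvw⟩ := ih b2 a c1 s1 r2 t2 (by omega) hb0
        (by rw [mul_comm, hPe]; exact hpos) hdet2 Y (x - k * Y) Z
      refine ⟨u, v, w, ?_⟩
      rw [← huvw, hb2, hr2, ht2, hb1, hc1, hr1, hs1, ht1]
      clear_value Y Z
      rw [hy, hz]; ring

/-- If `d * n - 1` divides `x ^ 2 + d`, then `n` is a sum of three squares. -/
lemma three_squares_of_dvd (n d x q : ℤ) (hq : 0 < q) (hd : 0 < d) (hqe : q = d * n - 1)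
    (hdvd : q ∣ x ^ 2 + d) : ∃ u v w : ℤ, n = u ^ 2 + v ^ 2 + w ^ 2 := by
  obtain ⟨e, he⟩ := hdvd
  have he0 : 0 < e := by
    by_contra hcon
    nlinarith [sq_nonneg x]
  obtain ⟨u, v, w, h⟩ := ternary_three_squares e.toNat e q n 0 1 x le_rfl he0
    (by nlinarith) (by subst hqe; linear_combination (-n) * he) 0 0 1
  exact ⟨u, v, w, by rw [← h]; ring⟩

open NumberTheorySymbols in
lemma exists_sq_add_dvd (p d : ℕ) (hp : p.Prime) (hp2 : Odd p) (hd : Odd d)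
    (h : p % 4 = 1 ∨ d % 4 = 3) (hJ : J(p | d) = 1) : ∃ x : ℤ, (p : ℤ) ∣ x ^ 2 + d := by
  have := Fact.mk hp
  have key : J(-(d : ℤ) | p) = 1 := by
    rw [jacobiSym.neg _ hp2]
    by_cases h1 : p % 4 = 1
    · rw [ZMod.χ₄_nat_one_mod_four h1, jacobiSym.quadratic_reciprocity_one_mod_four' hd h1, hJ]; rfl
    · have h3 : p % 4 = 3 := by
        obtain ⟨k, hk⟩ := hp2
        omega
      have h4 : d % 4 = 3 := by tauto
      rw [ZMod.χ₄_nat_three_mod_four h3, jacobiSym.quadratic_reciprocity_three_mod_four h4 h3, hJ]; rfl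
  obtain ⟨y, hy⟩ := ZMod.isSquare_of_jacobiSym_eq_one key
  obtain ⟨x, rfl⟩ := ZMod.intCast_surjective y
  refine ⟨x, ?_⟩
  rw [← ZMod.intCast_zmod_eq_zero_iff_dvd]
  push_cast at hy ⊢
  rw [pow_two, ← hy]; ring

lemma exists_prime_ap (m q : ℕ) (hq : 0 < q) (h : m.Coprime q) :
    ∃ p v : ℕ, p.Prime ∧ p = q * v + m := by
  have : NeZero q := ⟨hq.ne'⟩
  obtain ⟨p, hpm, hp, hmod⟩ := Nat.forall_exists_prime_gt_and_modEq m hq.ne' h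
  have := (Nat.modEq_iff_dvd' hpm.le).1 hmod.symm
  obtain ⟨v, hv⟩ := this
  exact ⟨p, v, hp, by omega⟩

open NumberTheorySymbols in
lemma three_squares_two_mod_four (n : ℕ) (hn : n % 4 = 2) :
    ∃ u v w : ℤ, (n : ℤ) = u ^ 2 + v ^ 2 + w ^ 2 := by
  have hcop : (n - 1).Coprime (4 * n) := by
    apply Nat.Coprime.mul_right
    · have : Odd (n - 1) := by rw [Nat.odd_iff]; omega
      exact (Nat.coprime_two_right.2 this).pow_right 2
    · rw [Nat.coprime_comm]
      have := (Nat.coprime_self_add_right (m := n - 1) (n := 1)).2 (by simp)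
      rw [Nat.sub_add_cancel (by omega), Nat.coprime_comm] at this
      exact this
  obtain ⟨p, v, hp, hpe⟩ := exists_prime_ap (n - 1) (4 * n) (by omega) hcop
  have hpz : (p : ℤ) = (4 * v + 1) * n - 1 := by
    rw [hpe]; push_cast [Nat.cast_sub (show 1 ≤ n by omega)]; ring
  have hp4 : p % 4 = 1 := by
    rw [hpe, mul_assoc]; omega
  have hdo : Odd (4 * v + 1) := by rw [Nat.odd_iff]; omega
  have hJ : J(p | 4 * v + 1) = 1 := by
    have : J((p : ℤ) | 4 * v + 1) = J(-1 | 4 * v + 1) := by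
      apply jacobiSym.mod_left'
      refine Int.emod_eq_emod_iff_emod_sub_eq_zero.2 (Int.emod_eq_zero_of_dvd ⟨n, ?_⟩)
      rw [hpz]; push_cast; ring
    rw [this, jacobiSym.at_neg_one hdo, ZMod.χ₄_nat_one_mod_four (by omega)]
  obtain ⟨x, hx⟩ := exists_sq_add_dvd p (4 * v + 1) hp (by rw [Nat.odd_iff]; omega) hdo (Or.inl hp4) hJ
  exact three_squares_of_dvd n ((4 * v + 1 : ℕ) : ℤ) x p (by exact_mod_cast hp.pos) (by positivity)
    (by rw [hpz]; push_cast; ring) hx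

open NumberTheorySymbols in
lemma three_squares_odd (n c m : ℕ) (hc : (c = 1 ∧ n % 8 = 3) ∨ (c = 3 ∧ n % 4 = 1))
    (hm : c * n = 2 * m + 1) :
    ∃ u v w : ℤ, (n : ℤ) = u ^ 2 + v ^ 2 + w ^ 2 := by
  have hm4 : m % 4 = 1 ∨ (c = 3 ∧ m % 4 = 3) := by
    rcases hc with ⟨rfl, h⟩ | ⟨rfl, h⟩ <;> omega
  have hmo : Odd m := by rw [Nat.odd_iff]; omega
  have hcop : m.Coprime (4 * n) := by
    apply Nat.Coprime.mul_right
    · exact (Nat.coprime_two_right.2 hmo).pow_right 2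
    · have h1 : m.Coprime (c * n) := by
        rw [hm]; simp
      exact h1.coprime_mul_left_right
  obtain ⟨p, v, hp, hpe⟩ := exists_prime_ap m (4 * n) (by omega) hcop
  have hpz : 2 * (p : ℤ) = (8 * v + c) * n - 1 := by
    have : (c : ℤ) * n = 2 * m + 1 := by exact_mod_cast hm
    rw [hpe]; push_cast; linear_combination -this
  have hp4 : p % 4 = m % 4 := by
    rw [hpe, mul_assoc]; omega
  have hpo : Odd p := by rw [Nat.odd_iff]; omega
  have hdo : Odd (8 * v + c) := by rw [Nat.odd_iff]; omega
  have hJ : J(p | 8 * v + c) = 1 := by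
    have h1 : J(-2 * (p : ℤ) | 8 * v + c) = J(1 | 8 * v + c) := by
      apply jacobiSym.mod_left'
      refine Int.emod_eq_emod_iff_emod_sub_eq_zero.2 (Int.emod_eq_zero_of_dvd ⟨-n, ?_⟩)
      push_cast; linear_combination -hpz
    have h2 : J(-2 | 8 * v + c) = 1 := by
      rw [jacobiSym.at_neg_two hdo, ZMod.χ₈'_nat_eq_if_mod_eight, if_neg (by omega), if_pos (by omega)]
    rw [jacobiSym.mul_left, h2, jacobiSym.one_left, one_mul] at h1
    exact h1
  obtain ⟨x, hx⟩ := exists_sq_add_dvd p (8 * v + c) hp hpo hdo (by omega) hJ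
  -- adjust the parity of `x`
  have hx2 : ∃ x : ℤ, (2 * p : ℤ) ∣ x ^ 2 + (8 * v + c : ℕ) := by
    have hcopz : IsCoprime (2 : ℤ) (p : ℤ) := by
      have := Nat.isCoprime_iff_coprime.2 (Nat.coprime_two_left.2 hpo)
      exact_mod_cast this
    rcases Int.even_or_odd x with he | ho
    · refine ⟨x + p, hcopz.mul_dvd ?_ ?_⟩
      · have : Odd (x + (p : ℤ)) := he.add_odd (by exact_mod_cast hpo)
        exact (this.pow.add_odd (by exact_mod_cast hdo)).two_dvd
      · have : (x + (p : ℤ)) ^ 2 + (8 * v + c : ℕ)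
          = (x ^ 2 + (8 * v + c : ℕ)) + p * (2 * x + p) := by ring
        rw [this]
        exact dvd_add hx (dvd_mul_right _ _)
    · exact ⟨x, hcopz.mul_dvd (ho.pow.add_odd (by exact_mod_cast hdo)).two_dvd hx⟩
  obtain ⟨x, hx⟩ := hx2
  have hp0 := hp.pos
  have hd0 := hdo.pos
  exact three_squares_of_dvd n ((8 * v + c : ℕ) : ℤ) x (2 * p) (by exact_mod_cast (by omega : 0 < 2 * p))
    (by exact_mod_cast hd0) (by rw [hpz]; push_cast; ring) hx

lemma lt_of_three_sq (b x y z : ℤ) (hb : 0 < b)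
    (h : 3 * (x ^ 2 + y ^ 2 + z ^ 2) < (b + 4) ^ 2) : -(b + 4) < x + y + z := by
  have h1 : (x + y + z) ^ 2 < (b + 4) ^ 2 := by
    nlinarith [sq_nonneg (x - y), sq_nonneg (y - z), sq_nonneg (x - z)]
  exact (abs_lt_of_sq_lt_sq' h1 (by omega)).1

lemma cauchy_finish (a b : ℕ) (hb : 0 < b) (h2 : 3 * a < b ^ 2 + 2 * b + 4) (x y z : ℤ)
    (h : 4 * (a : ℤ) - b ^ 2 = x ^ 2 + y ^ 2 + z ^ 2) (hxy : (x + y) % 2 = 0)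
    (hyz : (y + z) % 2 = 0) (h4 : (b + x + y + z) % 4 = 0) :
    ∃ s t u v : ℕ,
      a = s ^ 2 + t ^ 2 + u ^ 2 + v ^ 2 ∧ b = s + t + u + v := by
  have hbz : (0 : ℤ) < b := by exact_mod_cast hb
  have h2z : 3 * (a : ℤ) < b ^ 2 + 2 * b + 4 := by exact_mod_cast h2
  have hbd : 3 * (x ^ 2 + y ^ 2 + z ^ 2) < ((b : ℤ) + 4) ^ 2 := by rw [← h]; nlinarith
  have b1 := lt_of_three_sq b x y z hbz hbd
  have b2 := lt_of_three_sq b x (-y) (-z) hbz (by simpa using hbd)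
  have b3 := lt_of_three_sq b (-x) y (-z) hbz (by simpa using hbd)
  have b4 := lt_of_three_sq b (-x) (-y) z hbz (by simpa using hbd)
  obtain ⟨s, hs⟩ : ∃ s : ℕ, 4 * (s : ℤ) = b + x + y + z := ⟨((b + x + y + z) / 4).toNat, by omega⟩
  obtain ⟨t, ht⟩ : ∃ s : ℕ, 4 * (s : ℤ) = b + x - y - z := ⟨((b + x - y - z) / 4).toNat, by omega⟩
  obtain ⟨u, hu⟩ : ∃ s : ℕ, 4 * (s : ℤ) = b - x + y - z := ⟨((b - x + y - z) / 4).toNat, by omega⟩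
  obtain ⟨v, hv⟩ : ∃ s : ℕ, 4 * (s : ℤ) = b - x - y + z := ⟨((b - x - y + z) / 4).toNat, by omega⟩
  refine ⟨s, t, u, v, ?_, by omega⟩
  have key : 16 * (a : ℤ) = (4 * s) ^ 2 + (4 * t) ^ 2 + (4 * u) ^ 2 + (4 * v) ^ 2 := by
    rw [hs, ht, hu, hv]; linear_combination 4 * h
  have : (a : ℤ) = s ^ 2 + t ^ 2 + u ^ 2 + v ^ 2 := by linarith
  exact_mod_cast this

lemma sq_emod_four (x : ℤ) : (x ^ 2 % 4 = 0 ∧ x % 2 = 0) ∨ (x ^ 2 % 8 = 1 ∧ x % 2 = 1) := by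
  rcases Int.even_or_odd' x with ⟨k, rfl | rfl⟩
  · left; constructor
    · ring_nf; omega
    · omega
  · right; constructor
    · obtain ⟨j, hj⟩ := Int.even_mul_succ_self k
      have : (2 * k + 1) ^ 2 = 8 * j + 1 := by linear_combination 4 * hj
      omega
    · omega

theorem cauchy_lemma_variant (a b : ℕ) (ha : 0 < a) (hb : 0 < b)
    (h1 : b ^ 2 < 4 * a) (h2 : 3 * a < b ^ 2 + 2 * b + 4)
    (hpar : (Odd a ∧ Odd b) ∨ (a % 4 = 2 ∧ Even b)) :
    ∃ s t u v : ℕ,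
      a = s ^ 2 + t ^ 2 + u ^ 2 + v ^ 2 ∧ b = s + t + u + v := by
  rcases hpar with ⟨hao, hbo⟩ | ⟨ha2, c, hc⟩
  · have hbm := sq_emod_four b
    have hb1 : b % 2 = 1 := Nat.odd_iff.1 hbo
    have ha1 : a % 2 = 1 := Nat.odd_iff.1 hao
    have hb8 : b ^ 2 % 8 = 1 := by
      rcases hbm with h | h
      · omega
      · exact_mod_cast h.1
    obtain ⟨x, y, z, h⟩ := three_squares_odd (4 * a - b ^ 2) 1 ((4 * a - b ^ 2 - 1) / 2)
      (Or.inl ⟨rfl, by omega⟩) (by omega)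
    rw [Nat.cast_sub h1.le] at h
    push_cast at h
    have hm : (4 * (a : ℤ) - b ^ 2) % 8 = 3 := by
      have : ((b ^ 2 : ℕ) : ℤ) % 8 = 1 := by exact_mod_cast hb8
      push_cast at this
      omega
    have hx := sq_emod_four x
    have hy := sq_emod_four y
    have hz := sq_emod_four z
    by_cases h4 : (b + x + y + z) % 4 = 0
    · exact cauchy_finish a b hb h2 x y z h (by omega) (by omega) h4
    · exact cauchy_finish a b hb h2 (-x) y z (by rw [h]; ring) (by omega) (by omega) (by omega)
  · have hcc : b = 2 * c := by omega
    subst hcc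
    have hca : c ^ 2 < a := by nlinarith
    have hcm : (c ^ 2 % 4 = 0 ∧ c % 2 = 0) ∨ (c ^ 2 % 8 = 1 ∧ c % 2 = 1) := by
      exact_mod_cast sq_emod_four c
    obtain ⟨x, y, z, h⟩ : ∃ x y z : ℤ, ((a - c ^ 2 : ℕ) : ℤ) = x ^ 2 + y ^ 2 + z ^ 2 := by
      rcases hcm with hh | hh
      · exact three_squares_two_mod_four _ (by omega)
      · exact three_squares_odd _ 3 ((3 * (a - c ^ 2) - 1) / 2) (Or.inr ⟨rfl, by omega⟩) (by omega)
    rw [Nat.cast_sub hca.le] at h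
    have hcz : ((c ^ 2 : ℕ) : ℤ) % 2 = (c : ℤ) % 2 := by omega
    have hx := sq_emod_four x
    have hy := sq_emod_four y
    have hz := sq_emod_four z
    refine cauchy_finish a (2 * c) hb h2 (2 * x) (2 * y) (2 * z) ?_ (by omega) (by omega) ?_
    · push_cast at h ⊢; linear_combination 4 * h
    · push_cast; omega
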